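/- arXiv:2411.13967 — 2 statements merged into one kernel-verified Lean document; each statement's English description precedes it below -/
import Mathlib

section
/- (Macaulay) Let K be a field, let f_1,…,f_n ∈ K[x_1,…,x_n] be homogeneous polynomials of total degrees d_1,…,d_n ≥ 1, let 𝔪 = (x_1,…,x_n) and d = Σ_{k=1}^{n} d_k − n + 1. Then √(f_1,…,f_n) = 𝔪 if and only if 𝔪^d ⊆ (f_1,…,f_n). -/
open Polynomial MvPolynomial

/-- `f` is a Casas–Alvero polynomial of degree `n`: it is monic of degree `n` and for each
`i ∈ {1, …, n-1}` it has a nonconstant common factor with its `i`-th Hasse derivative. -/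
def IsCasasAlvero {K : Type} [Field K] (n : ℕ) (f : K[X]) : Prop :=
  f.Monic ∧ f.natDegree = n ∧
    ∀ i ∈ Finset.Ioo 0 n,
      ∃ g : K[X], 0 < g.degree ∧ g ∣ f ∧ g ∣ Polynomial.hasseDeriv i f

/-- `p` is a bad prime for `n`: `p` is prime and there are an algebraically closed field `K` of
characteristic `p` and a Casas–Alvero polynomial of degree `n` over `K` which is not an `n`-th
power of a linear polynomial. -/
def IsBadPrime (n p : ℕ) : Prop :=
  p.Prime ∧ ∃ (K : Type) (_ : Field K), IsAlgClosed K ∧ CharP K p ∧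
    ∃ f : K[X], IsCasasAlvero n f ∧ ¬ ∃ b : K, f = (Polynomial.X - Polynomial.C b) ^ n

/-- The involution `Φ_j` on `K[x_1,…,x_m]`, sending `x_i ↦ x_i - x_j` for `i ≠ j` and
`x_j ↦ -x_j`. -/
noncomputable def Phi (K : Type) [CommRing K] {m : ℕ} (j : Fin m) :
    MvPolynomial (Fin m) K →ₐ[K] MvPolynomial (Fin m) K :=
  MvPolynomial.aeval fun i =>
    if i = j then -MvPolynomial.X j else MvPolynomial.X i - MvPolynomial.X j

/-- `Φ_j` for `j ∈ {1,…,n}` acting on `K[x_1,…,x_{n-1}]`; for `j = n` (the last index of `Fin n`)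
this is the identity. -/
noncomputable def PhiFull (K : Type) [CommRing K] (n : ℕ) (j : Fin n) :
    MvPolynomial (Fin (n - 1)) K →ₐ[K] MvPolynomial (Fin (n - 1)) K :=
  if h : (j : ℕ) < n - 1 then Phi K ⟨j, h⟩ else AlgHom.id K _

/-- `G_{T,i} = Φ_{j_i}(σ_i)`, where `i` ranges over `Fin (n-1)` (representing the degree `i+1`). -/
noncomputable def G (K : Type) [CommRing K] (n : ℕ) (T : Fin (n - 1) → Fin n)
    (i : Fin (n - 1)) : MvPolynomial (Fin (n - 1)) K :=
  PhiFull K n (T i) (MvPolynomial.esymm (Fin (n - 1)) K ((i : ℕ) + 1))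

/-- `d = (n² - 3n + 4)/2`. -/
def casasD (n : ℕ) : ℕ := (n ^ 2 - 3 * n + 4) / 2

/-- `C = binom((n²-n)/2, n-2)`, the number of monomials of degree `d` in `n-1` variables. -/
def casasC (n : ℕ) : ℕ := Nat.choose ((n ^ 2 - n) / 2) (n - 2)

/-- `D = Σ_{i=1}^{n-1} binom(d-i+n-2, n-2)`, the number of rows of `M_T`. -/
def casasDD (n : ℕ) : ℕ :=
  ∑ i ∈ Finset.Icc 1 (n - 1), Nat.choose (casasD n - i + n - 2) (n - 2)

/-- The matrix `M_T` over `ℤ`, whose rows, indexed by pairs `(i, α)` with `|α| = d - i`, are the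
coefficient vectors of `x^α · G_{T,i}` with respect to the monomials of degree `d`
(a monomial of degree `e` in `n-1` variables is encoded as an element of `Sym (Fin (n-1)) e`). -/
noncomputable def casasM (n : ℕ) (T : Fin (n - 1) → Fin n) :
    Matrix ((i : Fin (n - 1)) × Sym (Fin (n - 1)) (casasD n - ((i : ℕ) + 1)))
      (Sym (Fin (n - 1)) (casasD n)) ℤ :=
  fun r c =>
    MvPolynomial.coeff (Multiset.toFinsupp (c : Multiset (Fin (n - 1))))
      (MvPolynomial.monomial (Multiset.toFinsupp (r.2 : Multiset (Fin (n - 1)))) 1 * G ℤ n T r.1)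

/-- `J_T`: the greatest common divisor of all `C × C` minors of `M_T`. -/
noncomputable def casasJ (n : ℕ) (T : Fin (n - 1) → Fin n) : ℤ :=
  Finset.gcd (Finset.univ.filter fun
      f : Sym (Fin (n - 1)) (casasD n) →
        (i : Fin (n - 1)) × Sym (Fin (n - 1)) (casasD n - ((i : ℕ) + 1)) =>
      Function.Injective f)
    fun f => ((casasM n T).submatrix f id).det

/-- The upper bound `C! · ∏_{i=1}^{n-1} binom(i+n-2, n-2)^binom(d-i+n-2, n-2)`. -/
def casasBound (n : ℕ) : ℕ :=
  (casasC n).factorial * ∏ i ∈ Finset.Icc 1 (n - 1),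
    Nat.choose (i + n - 2) (n - 2) ^ Nat.choose (casasD n - i + n - 2) (n - 2)

/-! ### Auxiliary material for Macaulay's theorem -/

section MacaulayAux

attribute [local instance] MvPolynomial.gradedAlgebra

lemma mac_hc_mul {K : Type} [Field K] {n : ℕ} {f : MvPolynomial (Fin n) K} {d : ℕ}
    (hf : f.IsHomogeneous d) (v : MvPolynomial (Fin n) K) (e : ℕ) :
    homogeneousComponent (d + e) (f * v) = f * homogeneousComponent e v := by
  have h := DirectSum.coe_decompose_mul_add_of_left_mem (homogeneousSubmodule (Fin n) K)
    (a := f) (b := v) (i := d) (j := e) hf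
  have h1 := decomposition.decompose'_apply (f * v) (d + e)
  have h2 := decomposition.decompose'_apply v e
  rw [← h1, ← h2]
  exact h

/-- The ideal generated by the first `k` members of a sequence. -/
def macJ {R : Type} [CommRing R] (f : ℕ → R) (k : ℕ) : Ideal R :=
  Ideal.span (f '' Set.Iio k)

lemma macJ_zero {R : Type} [CommRing R] (f : ℕ → R) : macJ f 0 = ⊥ := by
  simp [macJ]

lemma macJ_succ {R : Type} [CommRing R] (f : ℕ → R) (k : ℕ) :
    macJ f (k + 1) = macJ f k ⊔ Ideal.span {f k} := by
  have : Set.Iio (k + 1) = Set.Iio k ∪ {k} := by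
    ext x; simp only [Set.mem_Iio, Set.mem_union, Set.mem_singleton_iff]; omega
  rw [macJ, macJ, this, Set.image_union, Ideal.span_union, Set.image_singleton]

lemma macJ_map {R S : Type} [CommRing R] [CommRing S] (φ : R →+* S) (f : ℕ → R) (k : ℕ) :
    (macJ f k).map φ = macJ (fun i => φ (f i)) k := by
  rw [macJ, macJ, Ideal.map_span, ← Set.image_comp]
  rfl

lemma macJ_mem_succ {R : Type} [CommRing R] {f : ℕ → R} {k : ℕ} {u : R} :
    u ∈ macJ f (k + 1) ↔ ∃ v, u - f k * v ∈ macJ f k := by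
  rw [macJ_succ, Submodule.mem_sup]
  constructor
  · rintro ⟨y, hy, z, hz, rfl⟩
    obtain ⟨v, rfl⟩ := Ideal.mem_span_singleton'.1 hz
    exact ⟨v, by convert hy using 1; ring⟩
  · rintro ⟨v, hv⟩
    exact ⟨_, hv, f k * v, Ideal.mem_span_singleton'.2 ⟨v, mul_comm _ _⟩, by ring⟩

lemma mac_mem_sup {R : Type} [CommRing R] {J : Ideal R} {l u : R} :
    u ∈ J ⊔ Ideal.span {l} ↔ ∃ v, u - l * v ∈ J := by
  rw [Submodule.mem_sup]
  constructor
  · rintro ⟨y, hy, z, hz, rfl⟩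
    obtain ⟨v, rfl⟩ := Ideal.mem_span_singleton'.1 hz
    exact ⟨v, by convert hy using 1; ring⟩
  · rintro ⟨v, hv⟩
    exact ⟨_, hv, l * v, Ideal.mem_span_singleton'.2 ⟨v, mul_comm _ _⟩, by ring⟩

lemma macJ_hom {K : Type} [Field K] {n : ℕ} {f : ℕ → MvPolynomial (Fin n) K} {d : ℕ → ℕ}
    (hf : ∀ i, (f i).IsHomogeneous (d i)) (k : ℕ) :
    (macJ f k).IsHomogeneous (homogeneousSubmodule (Fin n) K) := by
  apply Ideal.homogeneous_span
  rintro _ ⟨i, _, rfl⟩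
  exact ⟨d i, hf i⟩

/-- splitting off a homogeneous multiple of a homogeneous element -/
lemma mac_split {K : Type} [Field K] {n : ℕ} {J : Ideal (MvPolynomial (Fin n) K)}
    (hJ : J.IsHomogeneous (homogeneousSubmodule (Fin n) K))
    {l : MvPolynomial (Fin n) K} {d e : ℕ} (hl : l.IsHomogeneous d)
    {u : MvPolynomial (Fin n) K} (hu : u.IsHomogeneous (d + e))
    (h : u ∈ J ⊔ Ideal.span {l}) : ∃ v, v.IsHomogeneous e ∧ u - l * v ∈ J := by
  obtain ⟨v, hv⟩ := mac_mem_sup.1 h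
  refine ⟨homogeneousComponent e v, homogeneousComponent_isHomogeneous _ _, ?_⟩
  have := (mem_iff_homogeneousComponent_mem hJ _).1 hv (d + e)
  rwa [map_sub, mac_hc_mul hl, homogeneousComponent_eq_self hu] at this

/-- graded Krull intersection -/
lemma mac_inter {K : Type} [Field K] {n : ℕ} {J : Ideal (MvPolynomial (Fin n) K)}
    (hJ : J.IsHomogeneous (homogeneousSubmodule (Fin n) K))
    {l : MvPolynomial (Fin n) K} (hl : l.IsHomogeneous 1) {u : MvPolynomial (Fin n) K}
    (h : ∀ m : ℕ, ∃ v, u - l ^ m * v ∈ J) : u ∈ J := by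
  rw [mem_iff_homogeneousComponent_mem hJ]
  intro e
  obtain ⟨v, hv⟩ := h (e + 1)
  have := (mem_iff_homogeneousComponent_mem hJ _).1 hv e
  have hz : homogeneousComponent e (l ^ (e + 1) * v) = 0 := by
    have h1 : (l ^ (e + 1)).IsHomogeneous (e + 1) := by simpa using hl.pow (e + 1)
    have h3 := decomposition.decompose'_apply (l ^ (e + 1) * v) e
    rw [← h3]
    exact DirectSum.coe_decompose_mul_of_left_mem_of_not_le
      (homogeneousSubmodule (Fin n) K) (a := l ^ (e + 1)) (b := v) (i := e + 1) (n := e) h1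
      (by omega)
  rwa [map_sub, hz, sub_zero] at this

/-- swapping `l` and `g` in a regular sequence -/
lemma mac_swap {K : Type} [Field K] {n : ℕ} {J : Ideal (MvPolynomial (Fin n) K)}
    (hJ : J.IsHomogeneous (homogeneousSubmodule (Fin n) K))
    {l g : MvPolynomial (Fin n) K} (hl : l.IsHomogeneous 1)
    (h1 : ∀ u, l * u ∈ J → u ∈ J)
    (h2 : ∀ u, g * u ∈ J ⊔ Ideal.span {l} → u ∈ J ⊔ Ideal.span {l}) :
    (∀ u, g * u ∈ J → u ∈ J) ∧
      ∀ u, l * u ∈ J ⊔ Ideal.span {g} → u ∈ J ⊔ Ideal.span {g} := by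
  constructor
  · intro u hu
    apply mac_inter hJ hl
    suffices H : ∀ m : ℕ, ∃ v, u - l ^ m * v ∈ J ∧ g * v ∈ J from
      fun m => let ⟨v, hv, _⟩ := H m; ⟨v, hv⟩
    intro m
    induction m with
    | zero => exact ⟨u, by simp, hu⟩
    | succ m ih =>
      obtain ⟨v, hv, hgv⟩ := ih
      obtain ⟨w, hw⟩ := mac_mem_sup.1 (h2 v (Ideal.mem_sup_left hgv))
      refine ⟨w, ?_, h1 _ ?_⟩
      · have := J.add_mem hv (J.mul_mem_left (l ^ m) hw)
        convert this using 1; ring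
      · have := J.sub_mem hgv (J.mul_mem_left g hw)
        convert this using 1; ring
  · intro u hu
    obtain ⟨v, hv⟩ := mac_mem_sup.1 hu
    have h3 : g * v ∈ J ⊔ Ideal.span {l} :=
      mac_mem_sup.2 ⟨u, by have := J.neg_mem hv; convert this using 1; ring⟩
    obtain ⟨w, hw⟩ := mac_mem_sup.1 (h2 v h3)
    refine mac_mem_sup.2 ⟨w, h1 _ ?_⟩
    have := J.add_mem hv (J.mul_mem_left g hw)
    convert this using 1; ring

/-- eliminating a linear form -/
lemma mac_proj {K : Type} [Field K] {n : ℕ} {l : MvPolynomial (Fin (n + 1)) K}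
    (hl : l.IsHomogeneous 1) (hl0 : l ≠ 0) :
    ∃ (φ : MvPolynomial (Fin (n + 1)) K →ₐ[K] MvPolynomial (Fin n) K)
      (s : MvPolynomial (Fin n) K →ₐ[K] MvPolynomial (Fin (n + 1)) K),
      (∀ u, φ (s u) = u) ∧ (∀ u, s (φ u) - u ∈ Ideal.span {l}) ∧ φ l = 0 ∧
      (∀ u e, u.IsHomogeneous e → (φ u).IsHomogeneous e) ∧
      (∀ u e, u.IsHomogeneous e → (s u).IsHomogeneous e) := by
  obtain ⟨c, hc⟩ : ∃ c : Fin (n + 1) → K, l = ∑ i, MvPolynomial.C (c i) * MvPolynomial.X i := by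
    have h : l ∈ homogeneousSubmodule (Fin (n + 1)) K 1 := hl
    rw [homogeneousSubmodule_one_eq_span_X, Submodule.mem_span_range_iff_exists_fun] at h
    obtain ⟨c, hc⟩ := h
    exact ⟨c, by rw [← hc]; simp [MvPolynomial.smul_eq_C_mul]⟩
  obtain ⟨j, hj⟩ : ∃ j, c j ≠ 0 := by
    by_contra! h
    exact hl0 (by rw [hc]; simp [h])
  rw [Fin.sum_univ_succAbove _ j] at hc
  let t : MvPolynomial (Fin n) K := -∑ k, MvPolynomial.C ((c j)⁻¹ * c (j.succAbove k)) * MvPolynomial.X k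
  have ht : t.IsHomogeneous 1 :=
    (IsHomogeneous.sum _ _ _ fun k _ => isHomogeneous_C_mul_X _ _).neg
  let g : Fin (n + 1) → MvPolynomial (Fin n) K := j.insertNth t (fun k => MvPolynomial.X k)
  have hgj : g j = t := by simp [g]
  have hgk : ∀ k, g (j.succAbove k) = MvPolynomial.X k := by simp [g]
  have hC : MvPolynomial.C (c j) * MvPolynomial.C ((c j)⁻¹) = (1 : MvPolynomial (Fin n) K) := by
    rw [← MvPolynomial.C_mul, mul_inv_cancel₀ hj, MvPolynomial.C_1]
  have hC' : MvPolynomial.C (c j) * MvPolynomial.C ((c j)⁻¹) = (1 : MvPolynomial (Fin (n + 1)) K) := by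
    rw [← MvPolynomial.C_mul, mul_inv_cancel₀ hj, MvPolynomial.C_1]
  refine ⟨MvPolynomial.aeval g, rename j.succAbove, ?_, ?_, ?_, ?_, ?_⟩
  · intro u
    rw [aeval_rename]
    have : g ∘ j.succAbove = MvPolynomial.X := by ext1 k; simp [hgk]
    rw [this, MvPolynomial.aeval_X_left_apply]
  · intro u
    rw [← Ideal.Quotient.eq]
    have : (Ideal.Quotient.mkₐ K (Ideal.span {l})).comp
        ((rename j.succAbove).comp (MvPolynomial.aeval g)) = Ideal.Quotient.mkₐ K (Ideal.span {l}) := by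
      apply MvPolynomial.algHom_ext
      intro i
      simp only [AlgHom.comp_apply, MvPolynomial.aeval_X, Ideal.Quotient.mkₐ_eq_mk]
      rw [Ideal.Quotient.eq]
      rcases Fin.eq_self_or_eq_succAbove j i with rfl | ⟨k, rfl⟩
      · rw [hgj, Ideal.mem_span_singleton']
        refine ⟨-MvPolynomial.C ((c i)⁻¹), ?_⟩
        simp only [t, map_neg, map_sum, map_mul, rename_C, rename_X]
        rw [hc]
        simp only [mul_add, Finset.mul_sum]
        have e1 : -MvPolynomial.C ((c i)⁻¹) * (MvPolynomial.C (c i) * MvPolynomial.X i) = -(MvPolynomial.X i : MvPolynomial (Fin (n + 1)) K) := by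
          linear_combination (-(MvPolynomial.X i : MvPolynomial (Fin (n + 1)) K)) * hC'
        rw [e1, sub_eq_add_neg, add_comm (-(MvPolynomial.X i)), ← Finset.sum_neg_distrib]
        congr 1
        apply Finset.sum_congr rfl
        intro k _
        ring
      · simp [hgk]
    exact DFunLike.congr_fun this u
  · rw [hc]
    simp only [map_add, map_mul, map_sum, MvPolynomial.aeval_C, MvPolynomial.aeval_X, hgj, hgk, t, MvPolynomial.algebraMap_eq]
    rw [mul_neg, Finset.mul_sum, neg_add_eq_zero]
    apply Finset.sum_congr rfl
    intro k _
    linear_combination (MvPolynomial.C (c (j.succAbove k)) * MvPolynomial.X k) * hC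
  · intro u e hu
    have := hu.aeval (n := 1) (g := g) ?_
    · simpa using this
    · intro i
      rcases Fin.eq_self_or_eq_succAbove j i with rfl | ⟨k, rfl⟩
      · rw [hgj]; exact ht
      · rw [hgk]; exact isHomogeneous_X _ _
  · intro u e hu
    exact hu.rename_isHomogeneous

lemma mac_van_of_le {K : Type} [Field K] {n : ℕ} {I : Ideal (MvPolynomial (Fin n) K)} {N : ℕ}
    (h : Ideal.span (Set.range (MvPolynomial.X : Fin n → MvPolynomial (Fin n) K)) ^ N ≤ I) :
    ∀ e, N ≤ e → ∀ u : MvPolynomial (Fin n) K, u.IsHomogeneous e → u ∈ I := by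
  intro e he u hu
  apply h
  change u ∈ MvPolynomial.idealOfVars (Fin n) K ^ N
  rw [mem_pow_idealOfVars_iff]
  intro x hx
  by_contra hlt
  exact (mem_support_iff.1 hx) (hu.coeff_eq_zero (by omega))

lemma mac_van_of_radical {K : Type} [Field K] {n : ℕ} {I : Ideal (MvPolynomial (Fin n) K)}
    (h : ∀ i, MvPolynomial.X i ∈ I.radical) :
    ∃ N : ℕ, ∀ e, N ≤ e → ∀ u : MvPolynomial (Fin n) K, u.IsHomogeneous e → u ∈ I := by
  have h1 : Ideal.span (Set.range (MvPolynomial.X : Fin n → MvPolynomial (Fin n) K)) ≤ I.radical := by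
    rw [Ideal.span_le]
    rintro _ ⟨i, rfl⟩
    exact h i
  obtain ⟨N, hN⟩ := Ideal.exists_pow_le_of_le_radical_of_fg h1 (IsNoetherian.noetherian _)
  exact ⟨N, mac_van_of_le hN⟩

lemma mac_pow_split {K : Type} [Field K] {n : ℕ} {J : Ideal (MvPolynomial (Fin n) K)}
    (hJ : J.IsHomogeneous (homogeneousSubmodule (Fin n) K))
    {g : MvPolynomial (Fin n) K} {d : ℕ} (hg : g.IsHomogeneous d) {N : ℕ}
    (hN : ∀ e, N ≤ e → ∀ u : MvPolynomial (Fin n) K, u.IsHomogeneous (d + e) →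
      u ∈ J ⊔ Ideal.span {g}) (m : ℕ) :
    ∀ e, N ≤ e → ∀ u : MvPolynomial (Fin n) K, u.IsHomogeneous (m * d + e) →
      ∃ v, v.IsHomogeneous e ∧ u - g ^ m * v ∈ J := by
  induction m with
  | zero => intro e _ u hu; exact ⟨u, by simpa using hu, by simp⟩
  | succ m ih =>
    intro e he u hu
    have hu' : u.IsHomogeneous (d + (m * d + e)) := by convert hu using 1; ring
    obtain ⟨v, hv, hv'⟩ := mac_split hJ hg hu' (hN (m * d + e) (by nlinarith) u hu')
    obtain ⟨w, hw, hw'⟩ := ih e he v hv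
    refine ⟨w, hw, ?_⟩
    have := J.add_mem hv' (J.mul_mem_left g hw')
    convert this using 1; ring

lemma mac_relation {K : Type} [Field K] {n : ℕ} {J : Ideal (MvPolynomial (Fin n) K)}
    (hJ : J.IsHomogeneous (homogeneousSubmodule (Fin n) K))
    {g : MvPolynomial (Fin n) K} {d : ℕ} (hd : 1 ≤ d) (hg : g.IsHomogeneous d) {N : ℕ}
    (hN : ∀ e, N ≤ e → ∀ u : MvPolynomial (Fin n) K, u.IsHomogeneous e →
      u ∈ J ⊔ Ideal.span {g})
    {a b : MvPolynomial (Fin n) K} (ha : a.IsHomogeneous 1) (hb : b.IsHomogeneous 1) :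
    ∃ (e : ℕ) (c : Fin (e + 1) → K), (∃ i, c i ≠ 0) ∧
      ∑ i, MvPolynomial.C (c i) * (a ^ (i : ℕ) * b ^ (e - i)) ∈ J := by
  let W := homogeneousSubmodule (Fin n) K N
  have hW : Module.Finite K W := Module.Finite.iff_fg.2 (homogeneousSubmodule_fg (Fin n) K N)
  let r := Module.finrank K W
  let e := r * d + N
  let T : W →ₗ[K] (MvPolynomial (Fin n) K ⧸ J) :=
    (Ideal.Quotient.mkₐ K J).toLinearMap ∘ₗ (LinearMap.mulLeft K (g ^ r)) ∘ₗ W.subtype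
  have hv : ∀ i : Fin (e + 1), ∃ w : W, T w = Ideal.Quotient.mk J (a ^ (i : ℕ) * b ^ (e - i)) := by
    intro i
    have hh : (a ^ (i : ℕ) * b ^ (e - i)).IsHomogeneous (r * d + N) := by
      have := (ha.pow (i : ℕ)).mul (hb.pow (e - i))
      convert this using 1
      have := i.2
      omega
    obtain ⟨v, hv, hv'⟩ := mac_pow_split hJ hg (N := N)
      (fun e he u hu => hN (d + e) (by omega) u hu) r N le_rfl _ hh
    refine ⟨⟨v, hv⟩, ?_⟩
    exact (Ideal.Quotient.eq.2 hv').symm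
  choose w hw using hv
  have hdep : ¬ LinearIndependent K w := by
    intro h
    have h1 := h.fintype_card_le_finrank
    rw [Fintype.card_fin] at h1
    have : r ≤ e := by
      have : r * 1 ≤ r * d := Nat.mul_le_mul_left _ hd
      omega
    omega
  rw [Fintype.not_linearIndependent_iff] at hdep
  obtain ⟨c, hc, hi⟩ := hdep
  refine ⟨e, c, hi, ?_⟩
  rw [← Ideal.Quotient.eq_zero_iff_mem]
  have := congrArg T hc
  rw [map_sum, map_zero] at this
  rw [← this, map_sum]
  apply Finset.sum_congr rfl
  intro i _
  rw [map_smul, hw]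
  exact congrArg (Ideal.Quotient.mk J) (MvPolynomial.smul_eq_C_mul _ _).symm

lemma mac_pair {K : Type} [Field K] [Infinite K] {n : ℕ} {J : Ideal (MvPolynomial (Fin n) K)}
    (hJ : J.IsHomogeneous (homogeneousSubmodule (Fin n) K))
    {g : MvPolynomial (Fin n) K} {d : ℕ} (hd : 1 ≤ d) (hg : g.IsHomogeneous d) {N : ℕ}
    (hN : ∀ e, N ≤ e → ∀ u : MvPolynomial (Fin n) K, u.IsHomogeneous e →
      u ∈ J ⊔ Ideal.span {g})
    {a b : MvPolynomial (Fin n) K} (ha : a.IsHomogeneous 1) (hb : b.IsHomogeneous 1) :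
    ∃ l : MvPolynomial (Fin n) K, l.IsHomogeneous 1 ∧ a ∈ (J ⊔ Ideal.span {l}).radical ∧
      b ∈ (J ⊔ Ideal.span {l}).radical := by
  obtain ⟨e, c, ⟨i0, hi0⟩, hc⟩ := mac_relation hJ hd hg hN ha hb
  let q : Polynomial K := ∑ i : Fin (e + 1), Polynomial.monomial (e - i) (c i)
  have hq : q ≠ 0 := by
    intro h
    apply hi0
    have h1 : q.coeff (e - i0) = c i0 := by
      simp only [q, Polynomial.finsetSum_coeff, Polynomial.coeff_monomial]
      rw [Finset.sum_eq_single i0]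
      · simp
      · intro j _ hj
        rw [if_neg]
        intro h
        apply hj
        ext
        have := j.2
        have := i0.2
        omega
      · simp
    rw [← h1, h, Polynomial.coeff_zero]
  obtain ⟨x, hx⟩ : ∃ x, q.eval x ≠ 0 := by
    by_contra! h
    exact hq (Polynomial.funext fun x => by simp [h x])
  have hl : (b - MvPolynomial.C x * a).IsHomogeneous 1 := hb.sub (ha.C_mul x)
  refine ⟨b - MvPolynomial.C x * a, hl, ?_⟩
  set I := J ⊔ Ideal.span {b - MvPolynomial.C x * a} with hI
  have hlI : b - MvPolynomial.C x * a ∈ I := Ideal.mem_sup_right (Ideal.mem_span_singleton_self _)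
  have haI : a ∈ I.radical := by
    refine ⟨e, ?_⟩
    have h1 : MvPolynomial.C (q.eval x) * a ^ e ∈ I := by
      have h2 : ∑ i : Fin (e + 1), MvPolynomial.C (c i) * (a ^ (i : ℕ) * b ^ (e - i)) ∈ I :=
        Ideal.mem_sup_left hc
      rw [← Ideal.Quotient.eq_zero_iff_mem] at h2 ⊢
      have hb' : Ideal.Quotient.mk I b = Ideal.Quotient.mk I (MvPolynomial.C x * a) := Ideal.Quotient.eq.2 hlI
      rw [← h2]
      simp only [q, Polynomial.eval_finsetSum, Polynomial.eval_monomial, map_sum, map_mul,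
        map_pow, hb', Finset.sum_mul]
      apply Finset.sum_congr rfl
      intro i _
      have : e = i + (e - i) := by have := i.2; omega
      conv_lhs => rw [show ((Ideal.Quotient.mk I) a) ^ e =
        ((Ideal.Quotient.mk I) a) ^ ((i : ℕ) + (e - i)) by rw [← this]]
      ring
    have := I.mul_mem_left (MvPolynomial.C (q.eval x)⁻¹) h1
    rwa [← mul_assoc, ← MvPolynomial.C_mul, inv_mul_cancel₀ hx, MvPolynomial.C_1, one_mul] at this
  refine ⟨haI, ?_⟩
  have := I.radical.add_mem (Ideal.le_radical hlI) (I.radical.mul_mem_left (MvPolynomial.C x) haI)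
  convert this using 1; ring

lemma mac_exists_linear {K : Type} [Field K] [Infinite K] {n : ℕ}
    {J : Ideal (MvPolynomial (Fin (n + 1)) K)}
    (hJ : J.IsHomogeneous (homogeneousSubmodule (Fin (n + 1)) K))
    {g : MvPolynomial (Fin (n + 1)) K} {d : ℕ} (hd : 1 ≤ d) (hg : g.IsHomogeneous d) {N : ℕ}
    (hN : ∀ e, N ≤ e → ∀ u : MvPolynomial (Fin (n + 1)) K, u.IsHomogeneous e →
      u ∈ J ⊔ Ideal.span {g}) :
    ∃ l : MvPolynomial (Fin (n + 1)) K, l.IsHomogeneous 1 ∧ l ≠ 0 ∧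
      ∀ i, MvPolynomial.X i ∈ (J ⊔ Ideal.span {l}).radical := by
  have key : ∀ s : Finset (Fin (n + 1)), ∃ l : MvPolynomial (Fin (n + 1)) K, l.IsHomogeneous 1 ∧
      ∀ i ∈ s, MvPolynomial.X i ∈ (J ⊔ Ideal.span {l}).radical := by
    intro s
    induction s using Finset.induction_on with
    | empty => exact ⟨0, isHomogeneous_zero _ _ _, by simp⟩
    | insert j s _ ih =>
      obtain ⟨l, hl, h⟩ := ih
      obtain ⟨l', hl', h1, h2⟩ := mac_pair hJ hd hg hN hl (isHomogeneous_X K j)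
      refine ⟨l', hl', fun i hi => ?_⟩
      rcases Finset.mem_insert.1 hi with rfl | hi
      · exact h2
      · have hle : J ⊔ Ideal.span {l} ≤ (J ⊔ Ideal.span {l'}).radical :=
          sup_le (le_sup_left.trans Ideal.le_radical)
            ((Ideal.span_singleton_le_iff_mem _).2 h1)
        have := Ideal.radical_mono hle (h i hi)
        rwa [Ideal.radical_idem] at this
  obtain ⟨l, hl, h⟩ := key Finset.univ
  by_cases h0 : l = 0
  · refine ⟨MvPolynomial.X 0, isHomogeneous_X K 0, MvPolynomial.X_ne_zero 0, fun i => ?_⟩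
    have h1 := h i (Finset.mem_univ i)
    refine Ideal.radical_mono ?_ h1
    rw [h0]
    simp
  · exact ⟨l, hl, h0, fun i => h i (Finset.mem_univ i)⟩

lemma mac_main (K : Type) [Field K] [Infinite K] (n : ℕ) :
    ∀ (f : ℕ → MvPolynomial (Fin n) K) (d : ℕ → ℕ), (∀ i, 1 ≤ d i) →
    (∀ i, (f i).IsHomogeneous (d i)) →
    (∃ N, ∀ e, N ≤ e → ∀ u : MvPolynomial (Fin n) K, u.IsHomogeneous e → u ∈ macJ f n) →
    (∀ k < n, ∀ u, f k * u ∈ macJ f k → u ∈ macJ f k) ∧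
    (∀ e, ∑ i ∈ Finset.range n, (d i - 1) + 1 ≤ e → ∀ u : MvPolynomial (Fin n) K,
      u.IsHomogeneous e → u ∈ macJ f n) := by
  induction n with
  | zero =>
    intro f d _ _ _
    refine ⟨fun k hk => absurd hk (by omega), fun e he u hu => ?_⟩
    have h0 := isHomogeneous_of_isEmpty (R := K) (σ := Fin 0) u
    by_cases hu0 : u = 0
    · rw [hu0]; exact Ideal.zero_mem _
    · have := hu.inj_right h0 hu0
      omega
  | succ n ih =>
    intro f d hd hf hN
    obtain ⟨N, hN⟩ := hN
    have hhom := macJ_hom hf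
    have hN' := hN
    rw [macJ_succ] at hN'
    obtain ⟨l, hl, hl0, hrad⟩ := mac_exists_linear (hhom n) (hd n) (hf n) hN'
    obtain ⟨N', hV⟩ := mac_van_of_radical hrad
    obtain ⟨φ, s, hφs, hsφ, hφl, hφh, hsh⟩ := mac_proj hl hl0
    -- membership transfer
    have hmap : ∀ k u, φ u ∈ macJ (fun i => φ (f i)) k ↔ u ∈ macJ f k ⊔ Ideal.span {l} := by
      intro k u
      have e1 : macJ (fun i => φ (f i)) k = (macJ f k).map φ.toRingHom := (macJ_map φ.toRingHom f k).symm
      rw [e1]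
      constructor
      · intro h
        obtain ⟨w, hw, hw'⟩ := (Ideal.mem_map_iff_of_surjective φ.toRingHom
          (fun y => ⟨s y, hφs y⟩)).1 h
        have hw'' : φ w = φ u := hw'
        have h1 := hsφ u
        have h2 := hsφ w
        rw [hw''] at h2
        have h3 : u - w ∈ Ideal.span {l} := by
          have := Ideal.sub_mem _ h2 h1
          convert this using 1; ring
        have := Ideal.add_mem _ (Ideal.mem_sup_left hw : w ∈ macJ f k ⊔ Ideal.span {l})
          (Ideal.mem_sup_right h3)
        convert this using 1; ring
      · intro h
        obtain ⟨v, hv⟩ := mac_mem_sup.1 h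
        have := Ideal.mem_map_of_mem φ.toRingHom hv
        have e2 : φ.toRingHom (u - l * v) = φ u := by
          change φ (u - l * v) = φ u
          rw [map_sub, map_mul, hφl, zero_mul, sub_zero]
        rwa [e2] at this
    obtain ⟨ihr, ihb⟩ := ih (fun i => φ (f i)) d hd (fun i => hφh _ _ (hf i))
      ⟨N', fun e he u hu => by
        have := hV e he (s u) (hsh u e hu)
        rw [← hmap, hφs] at this
        exact this⟩
    have hreg : ∀ k < n, ∀ u, f k * u ∈ macJ f k ⊔ Ideal.span {l} →
        u ∈ macJ f k ⊔ Ideal.span {l} := by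
      intro k hk u hu
      rw [← hmap] at hu ⊢
      rw [map_mul] at hu
      exact ihr k hk _ hu
    have hlreg : ∀ k ≤ n, ∀ u, l * u ∈ macJ f k → u ∈ macJ f k := by
      intro k
      induction k with
      | zero =>
        intro _ u hu
        rw [macJ_zero, Ideal.mem_bot] at hu ⊢
        exact (mul_eq_zero.1 hu).resolve_left hl0
      | succ k ihk =>
        intro hk
        rw [macJ_succ]
        exact (mac_swap (hhom k) hl (ihk (by omega)) (hreg k (by omega))).2
    have hlpow : ∀ m u, l ^ m * u ∈ macJ f n → u ∈ macJ f n := by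
      intro m
      induction m with
      | zero => intro u hu; simpa using hu
      | succ m ihm =>
        intro u hu
        rw [pow_succ, mul_assoc] at hu
        exact hlreg n le_rfl _ (ihm _ hu)
    refine ⟨?_, ?_⟩
    · intro k hk u hu
      rcases Nat.lt_succ_iff_lt_or_eq.1 hk with hk | rfl
      · exact (mac_swap (hhom k) hl (hlreg k hk.le) (hreg k hk)).1 u hu
      · have h1 : l ^ N ∈ macJ f (k + 1) := hN N le_rfl _ (by simpa using hl.pow N)
        obtain ⟨w, hw⟩ := macJ_mem_succ.1 h1
        apply hlpow N
        have := Ideal.add_mem _ (Ideal.mul_mem_left _ u hw) (Ideal.mul_mem_left _ w hu)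
        convert this using 1; ring
    · intro e he u hu
      rw [Finset.sum_range_succ] at he
      set S := ∑ i ∈ Finset.range n, (d i - 1) with hS
      have hdn := hd n
      obtain ⟨e', rfl⟩ : ∃ e', e = d n + e' := ⟨e - d n, by omega⟩
      have hu1 : (l ^ N * u).IsHomogeneous (d n + (N * 1 + e')) := by
        have := (hl.pow N).mul hu
        convert this using 1; ring
      have h1 := hN' _ (by omega) _ hu1
      obtain ⟨v, hv, hv'⟩ := mac_split (hhom n) (hf n) hu1 h1
      obtain ⟨w, hw, hw'⟩ := mac_pow_split (hhom n) hl (N := S)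
        (fun e he u hu => (hmap n u).1 (ihb (1 + e) (by omega) _ (hφh _ _ hu))) N e'
        (by omega) v hv
      refine macJ_mem_succ.2 ⟨w, hlpow N _ ?_⟩
      have := Ideal.add_mem _ hv' (Ideal.mul_mem_left _ (f n) hw')
      convert this using 1; ring

/-- ideal membership descends along a field extension -/
lemma mac_descent {K L : Type} [Field K] [Field L] [Algebra K L] {n : ℕ}
    (f : Fin n → MvPolynomial (Fin n) K) (u : MvPolynomial (Fin n) K)
    (h : MvPolynomial.map (algebraMap K L) u ∈
      Ideal.span (Set.range fun i => MvPolynomial.map (algebraMap K L) (f i))) :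
    u ∈ Ideal.span (Set.range f) := by
  obtain ⟨ρ, hρ⟩ := (Algebra.linearMap K L).exists_leftInverse_of_injective
    (LinearMap.ker_eq_bot.2 (algebraMap K L).injective)
  have hρ1 : ∀ c, ρ (algebraMap K L c) = c := fun c => DFunLike.congr_fun hρ c
  let P0 : MvPolynomial (Fin n) L → MvPolynomial (Fin n) K :=
    AddMonoidAlgebra.map ρ.toAddMonoidHom
  have hP0 : ∀ p m, (P0 p).coeff m = ρ (p.coeff m) :=
    fun p m => coeff_addMonoidAlgebraMap ρ.toAddMonoidHom p m
  let P : MvPolynomial (Fin n) L →+ MvPolynomial (Fin n) K :=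
    AddMonoidHom.mk' P0 fun p q => by
      ext m
      rw [MvPolynomial.coeff_add, hP0, hP0, hP0, MvPolynomial.coeff_add, map_add]
  have hPc : ∀ p m, (P p).coeff m = ρ (p.coeff m) := hP0
  have hPmul : ∀ (a : MvPolynomial (Fin n) K) p,
      P (p * MvPolynomial.map (algebraMap K L) a) = P p * a := by
    intro a p
    ext m
    rw [hPc, MvPolynomial.coeff_mul, MvPolynomial.coeff_mul, map_sum]
    apply Finset.sum_congr rfl
    intro x _
    rw [MvPolynomial.coeff_map, hPc, mul_comm, ← Algebra.smul_def, map_smul, smul_eq_mul, mul_comm]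
  have hP1 : P (MvPolynomial.map (algebraMap K L) u) = u := by
    ext m; rw [hPc, MvPolynomial.coeff_map, hρ1]
  obtain ⟨c, hc⟩ := Ideal.mem_span_range_iff_exists_fun.1 h
  rw [Ideal.mem_span_range_iff_exists_fun]
  refine ⟨fun i => P (c i), ?_⟩
  rw [← hP1, ← hc, map_sum]
  exact Finset.sum_congr rfl fun i _ => (hPmul _ _).symm

/-- a homogeneous polynomial of positive degree lies in the ideal of the variables -/
lemma mac_mem_vars {K : Type} [Field K] {n : ℕ} {u : MvPolynomial (Fin n) K} {e : ℕ}
    (he : 1 ≤ e) (hu : u.IsHomogeneous e) :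
    u ∈ Ideal.span (Set.range (MvPolynomial.X : Fin n → MvPolynomial (Fin n) K)) :=
  mac_van_of_le (N := 1) (by rw [pow_one]) e he u hu

/-- the ideal of the variables is radical -/
lemma mac_vars_radical {K : Type} [Field K] {n : ℕ} :
    (Ideal.span (Set.range (MvPolynomial.X : Fin n → MvPolynomial (Fin n) K))).radical =
      Ideal.span (Set.range (MvPolynomial.X : Fin n → MvPolynomial (Fin n) K)) := by
  refine le_antisymm ?_ Ideal.le_radical
  rintro u ⟨k, hk⟩
  have key : ∀ v : MvPolynomial (Fin n) K,
      v ∈ Ideal.span (Set.range (MvPolynomial.X : Fin n → MvPolynomial (Fin n) K)) ↔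
        constantCoeff v = 0 := by
    intro v
    constructor
    · intro hv
      have h1 : Ideal.span (Set.range (MvPolynomial.X : Fin n → MvPolynomial (Fin n) K)) ≤
          RingHom.ker (constantCoeff (σ := Fin n) (R := K)) := by
        rw [Ideal.span_le]
        rintro _ ⟨i, rfl⟩
        simp [RingHom.mem_ker]
      exact h1 hv
    · intro hv
      change v ∈ MvPolynomial.idealOfVars (Fin n) K
      rw [← pow_one (MvPolynomial.idealOfVars (Fin n) K), mem_pow_idealOfVars_iff]
      intro x hx
      by_contra hlt
      have hx0 : x = 0 := by
        have : Finsupp.degree x = 0 := by omega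
        exact (Finsupp.degree_eq_zero_iff x).1 this
      rw [MvPolynomial.mem_support_iff, hx0] at hx
      exact hx hv
  rw [key] at hk ⊢
  rw [map_pow] at hk
  exact eq_zero_of_pow_eq_zero hk

end MacaulayAux

/-- **Macaulay's theorem.** For homogeneous `f_1,…,f_n ∈ K[x_1,…,x_n]` of degrees `d_1,…,d_n ≥ 1`
and `d = Σ d_k - n + 1`, one has `√(f_1,…,f_n) = 𝔪` iff `𝔪^d ⊆ (f_1,…,f_n)`, where
`𝔪 = (x_1,…,x_n)`. -/
theorem macaulay (K : Type) [Field K] (n : ℕ) (f : Fin n → MvPolynomial (Fin n) K)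
    (d : Fin n → ℕ) (hd : ∀ i, 1 ≤ d i) (hf : ∀ i, (f i).IsHomogeneous (d i)) :
    (Ideal.span (Set.range f)).radical =
        Ideal.span (Set.range (MvPolynomial.X : Fin n → MvPolynomial (Fin n) K)) ↔
      Ideal.span (Set.range (MvPolynomial.X : Fin n → MvPolynomial (Fin n) K)) ^
          (∑ i, d i - n + 1) ≤ Ideal.span (Set.range f) := by
  constructor
  · intro hrad
    let L := AlgebraicClosure K
    let ι : MvPolynomial (Fin n) K →+* MvPolynomial (Fin n) L := MvPolynomial.map (algebraMap K L)
    let F : ℕ → MvPolynomial (Fin n) L := fun i => if h : i < n then ι (f ⟨i, h⟩) else 0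
    let D : ℕ → ℕ := fun i => if h : i < n then d ⟨i, h⟩ else 1
    have hD : ∀ i, 1 ≤ D i := by
      intro i
      by_cases h : i < n
      · simp only [D, dif_pos h]; exact hd _
      · simp only [D, dif_neg h]; exact le_rfl
    have hF : ∀ i, (F i).IsHomogeneous (D i) := by
      intro i
      by_cases h : i < n
      · simp only [D, F, dif_pos h]; exact (hf _).map _
      · simp only [D, F, dif_neg h]; exact isHomogeneous_zero _ _ _
    have hJ : macJ F n = Ideal.span (Set.range fun i => ι (f i)) := by
      rw [macJ]
      congr 1
      ext x
      constructor
      · rintro ⟨i, hi, rfl⟩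
        have hi' : i < n := hi
        exact ⟨⟨i, hi'⟩, by simp only [F, dif_pos hi']⟩
      · rintro ⟨i, rfl⟩
        exact ⟨i, i.2, by simp only [F, dif_pos i.2, Fin.eta]⟩
    have hJmap : macJ F n = (Ideal.span (Set.range f)).map ι := by
      rw [hJ, Ideal.map_span, ← Set.range_comp]
      rfl
    have hN : ∃ N, ∀ e, N ≤ e → ∀ u : MvPolynomial (Fin n) L, u.IsHomogeneous e →
        u ∈ macJ F n := by
      apply mac_van_of_radical
      intro i
      have h1 : (MvPolynomial.X i : MvPolynomial (Fin n) K) ∈ (Ideal.span (Set.range f)).radical := by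
        rw [hrad]; exact Ideal.subset_span ⟨i, rfl⟩
      obtain ⟨k, hk⟩ := h1
      refine ⟨k, ?_⟩
      have := Ideal.mem_map_of_mem ι hk
      rw [hJmap]
      simpa [ι] using this
    have hmain := (mac_main L n F D hD hF hN).2
    have hsum : ∑ i ∈ Finset.range n, (D i - 1) = ∑ i, d i - n := by
      rw [Finset.sum_range]
      have h1 : ∀ i : Fin n, D i = d i := fun i => by simp only [D, dif_pos i.2, Fin.eta]
      simp only [h1]
      have h2 : ∑ i, d i = ∑ i, (d i - 1) + n := by
        have : ∑ i, d i = ∑ i : Fin n, ((d i - 1) + 1) :=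
          Finset.sum_congr rfl fun i _ => by have := hd i; omega
        rw [this, Finset.sum_add_distrib]
        simp
      omega
    rw [hsum] at hmain
    have hpow := pow_idealOfVars_eq_span (σ := Fin n) (R := K) (∑ i, d i - n + 1)
    change MvPolynomial.idealOfVars (Fin n) K ^ _ ≤ _
    rw [hpow, Ideal.span_le]
    rintro _ ⟨x, hx, rfl⟩
    apply mac_descent (L := L)
    have hmon : (MvPolynomial.monomial x (1 : K)).IsHomogeneous (∑ i, d i - n + 1) :=
      isHomogeneous_monomial _ hx
    have := hmain _ le_rfl _ (hmon.map (algebraMap K L))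
    rw [hJ] at this
    exact this
  · intro h
    apply le_antisymm
    · rw [← mac_vars_radical]
      apply Ideal.radical_mono
      rw [Ideal.span_le]
      rintro _ ⟨i, rfl⟩
      exact mac_mem_vars (hd i) (hf i)
    · intro u hu
      exact ⟨_, h (Ideal.pow_mem_pow hu _)⟩
end

section
/- (Ghosh) Let n ≥ 2, let p be a prime or 0, and let K be an algebraically closed field of characteristic p. Then every Casas–Alvero polynomial of degree n over K is an n-th power of a linear polynomial if and only if for every T = (j_1,…,j_{n−1}) ∈ {1,…,n}^{n−1}, the sequence (G_{T,1},…,G_{T,n−1}) is a regular sequence in K[x_1,…,x_{n−1}]. -/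
open Polynomial MvPolynomial

namespace CasasAux

open RingTheory.Sequence IsLocalRing Module

lemma wb_nat {x : WithBot ℕ∞} (h : x ≠ ⊥) {n : ℕ} (hn : x ≤ n) : ∃ k : ℕ, x = k ∧ k ≤ n := by
  cases x with
  | bot => exact absurd rfl h
  | coe x =>
    cases x with
    | top => 
      exfalso
      have : (⊤ : ℕ∞) ≤ (n : ℕ∞) := by exact_mod_cast hn
      simp at this
    | coe k => exact ⟨k, rfl, by exact_mod_cast hn⟩

section loc
universe u v
set_option linter.unusedSectionVars false
variable {A : Type u} [CommRing A] [IsLocalRing A] [IsNoetherianRing A]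

lemma dim_quot_cons {M : Type v} [AddCommGroup M] [Module A M] (b : A) (bs : List A) :
    supportDim A (M ⧸ Ideal.ofList (b :: bs) • (⊤ : Submodule A M)) =
    supportDim A (QuotSMulTop b M ⧸ Ideal.ofList bs • (⊤ : Submodule A (QuotSMulTop b M))) :=
  supportDim_eq_of_equiv (Submodule.quotOfListConsSMulTopEquivQuotSMulTopInner M b _)

lemma dim_quot_nil {M : Type v} [AddCommGroup M] [Module A M] :
    supportDim A (M ⧸ Ideal.ofList ([] : List A) • (⊤ : Submodule A M)) = supportDim A M := by
  rw [Ideal.ofList_nil, Submodule.bot_smul]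
  exact supportDim_eq_of_equiv (Submodule.quotEquivOfEqBot ⊥ rfl)

lemma krull_list (bs : List A) : ∀ (M : Type v) [AddCommGroup M] [Module A M] [Module.Finite A M],
    (∀ b ∈ bs, b ∈ maximalIdeal A) →
    supportDim A (M ⧸ Ideal.ofList bs • (⊤ : Submodule A M)) ≤ 0 →
    supportDim A M ≤ bs.length := by
  induction bs with
  | nil => 
    intro M _ _ _ _ h
    rw [dim_quot_nil] at h
    simpa using h
  | cons b bs ih =>
    intro M _ _ _ hb h
    rw [dim_quot_cons] at h
    have := ih (QuotSMulTop b M) (fun c hc => hb c (by simp [hc])) h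
    have h2 := supportDim_le_supportDim_quotSMulTop_succ (M := M) (hb b (by simp))
    refine h2.trans ?_
    rw [List.length_cons]
    push_cast
    gcongr

lemma dim_comm {M : Type v} [AddCommGroup M] [Module A M] [Module.Finite A M] (x y : A) :
    supportDim A (QuotSMulTop x (QuotSMulTop y M)) =
      supportDim A (QuotSMulTop y (QuotSMulTop x M)) := by
  have h : Module.support A (QuotSMulTop x (QuotSMulTop y M)) =
      Module.support A (QuotSMulTop y (QuotSMulTop x M)) := by
    rw [support_quotSMulTop, support_quotSMulTop, support_quotSMulTop, support_quotSMulTop]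
    rw [Set.inter_right_comm]
  unfold supportDim
  rw [h]

/-- Avoidance for two positive dimensional modules. -/
lemma exists_param (M N : Type v) [AddCommGroup M] [Module A M] [Module.Finite A M]
    [AddCommGroup N] [Module A N] [Module.Finite A N]
    (hM : 0 < supportDim A M) (hN : 0 < supportDim A N) :
    ∃ y ∈ maximalIdeal A, supportDim A (QuotSMulTop y M) + 1 = supportDim A M ∧
      supportDim A (QuotSMulTop y N) + 1 = supportDim A N := by
  have key : ∀ (M : Type v) [AddCommGroup M] [Module A M] [Module.Finite A M],
      0 < supportDim A M → maximalIdeal A ∉ (annihilator A M).minimalPrimes := by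
    intro M _ _ _ h hm
    have : Subsingleton (Module.support A M) := by
      constructor
      rintro ⟨p, hp⟩ ⟨q, hq⟩
      have : ∀ p ∈ Module.support A M, p.asIdeal = maximalIdeal A := by
        intro p hp
        have h1 := mem_support_iff_of_finite.mp hp
        exact le_antisymm (IsLocalRing.le_maximalIdeal p.2.ne_top)
          (hm.2 ⟨p.2, h1⟩ (IsLocalRing.le_maximalIdeal p.2.ne_top))
      ext1
      ext1
      rw [this p hp, this q hq]
    have h0 : supportDim A M ≤ 0 := Order.krullDim_nonpos_of_subsingleton
    exact absurd h (not_lt.mpr h0)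
  have fin1 := (annihilator A M).finite_minimalPrimes_of_isNoetherianRing
  have fin2 := (annihilator A N).finite_minimalPrimes_of_isNoetherianRing
  have fin := fin1.union fin2
  by_contra! hcon
  have hsub : ((maximalIdeal A : Ideal A) : Set A) ⊆ ⋃ i ∈ (fin.toFinset : Set (Ideal A)), (i : Set A) := by
    intro y hy
    by_contra hny
    simp only [Set.mem_iUnion, not_exists, Set.Finite.coe_toFinset] at hny
    have e1 := supportDim_quotSMulTop_succ_eq_of_notMem_minimalPrimes_of_mem_maximalIdeal
      (M := M) (x := y) (fun p hp => hny p (Or.inl hp)) hy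
    have e2 := supportDim_quotSMulTop_succ_eq_of_notMem_minimalPrimes_of_mem_maximalIdeal
      (M := N) (x := y) (fun p hp => hny p (Or.inr hp)) hy
    exact hcon y hy e1 e2
  rw [Ideal.subset_union_prime (f := fun i => i) ⊤ ⊤] at hsub
  · obtain ⟨p, hp, hle⟩ := hsub
    rw [Set.Finite.mem_toFinset] at hp
    have hpm : p = maximalIdeal A := by
      have : p.IsPrime := by
        rcases hp with hp | hp <;> exact hp.1.1
      exact le_antisymm (IsLocalRing.le_maximalIdeal this.ne_top) hle
    subst hpm
    rcases hp with hp | hp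
    · exact key M hM hp
    · exact key N hN hp
  · intro i hi _ _
    rw [Set.Finite.mem_toFinset] at hi
    rcases hi with hp | hp <;> exact hp.1.1

lemma exists_sop (d : ℕ) : ∀ (M : Type v) [AddCommGroup M] [Module A M] [Module.Finite A M],
    supportDim A M = d → ∃ c : List A, c.length = d ∧ (∀ b ∈ c, b ∈ maximalIdeal A) ∧
      supportDim A (M ⧸ Ideal.ofList c • (⊤ : Submodule A M)) ≤ 0 := by
  induction d with
  | zero =>
    intro M _ _ _ h
    refine ⟨[], rfl, by simp, ?_⟩
    rw [dim_quot_nil, h]; simp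
  | succ d ih =>
    intro M _ _ _ h
    have hpos : 0 < supportDim A M := by
      rw [h]; exact_mod_cast Nat.succ_pos d
    obtain ⟨y, hy, h1, -⟩ := exists_param M M hpos hpos
    have : supportDim A (QuotSMulTop y M) = d := by
      rw [h] at h1
      push_cast at h1
      exact (ENat.WithBot.add_one_cancel).mp h1
    obtain ⟨c, hc, hcm, hcd⟩ := ih _ this
    refine ⟨y :: c, by simp [hc], ?_, ?_⟩
    · intro b hb
      rcases List.mem_cons.mp hb with rfl | hb
      · exact hy
      · exact hcm b hb
    · rw [dim_quot_cons]; exact hcd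

lemma cancel_one {x : WithBot ℕ∞} {d : ℕ} (h : x + 1 = ((d + 1 : ℕ) : WithBot ℕ∞)) : x = d := by
  push_cast at h
  exact (ENat.WithBot.add_one_cancel).mp h

/-- In a module having a regular sequence of length its dimension, each sop is regular. -/
lemma sop_regular (d : ℕ) : ∀ (M : Type v) [AddCommGroup M] [Module A M] [Module.Finite A M]
    (_ : supportDim A M = d) (a : List A) (_ : a.length = d) (_ : IsRegular M a)
    (b : List A) (_ : b.length = d) (_ : ∀ x ∈ b, x ∈ maximalIdeal A)
    (_ : supportDim A (M ⧸ Ideal.ofList b • (⊤ : Submodule A M)) ≤ 0), IsRegular M b := by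
  induction d with
  | zero =>
    intro M _ _ _ hd a ha har b hb hbm hbd
    rw [List.length_eq_zero_iff] at ha hb
    subst ha; subst hb; exact har
  | succ d ih =>
    intro M _ _ _ hd a ha har b hb hbm hbd
    obtain ⟨a₁, a, rfl⟩ := List.exists_cons_of_length_eq_add_one ha
    obtain ⟨b₁, b, rfl⟩ := List.exists_cons_of_length_eq_add_one hb
    simp only [List.length_cons, Nat.add_right_cancel_iff] at ha hb
    have hMnt : Nontrivial M := har.nontrivial
    have ham : ∀ x ∈ a₁ :: a, x ∈ maximalIdeal A := by
      intro x hx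
      have hx' : x ∈ Ideal.ofList (a₁ :: a) := Ideal.subset_span hx
      refine IsLocalRing.le_maximalIdeal ?_ hx'
      intro h
      apply har.top_ne_smul
      rw [h]
      simp
    obtain ⟨hr1, hr2⟩ := (isRegular_cons_iff M a₁ a).mp har
    have hda : supportDim A (QuotSMulTop a₁ M) = d := by
      apply cancel_one
      rw [← hd]
      exact supportDim_quotSMulTop_succ_eq_supportDim hr1 (ham a₁ (by simp))
    have hb1 : b₁ ∈ maximalIdeal A := hbm b₁ (by simp)
    have hbm' : ∀ x ∈ b, x ∈ maximalIdeal A := fun x hx => hbm x (by simp [hx])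
    have hbd' := hbd
    rw [dim_quot_cons] at hbd'
    have hdb : supportDim A (QuotSMulTop b₁ M) = d := by
      have h1 := krull_list b (QuotSMulTop b₁ M) hbm' hbd'
      rw [hb] at h1
      have h2 := supportDim_le_supportDim_quotSMulTop_succ (M := M) hb1
      have : Nontrivial (QuotSMulTop b₁ M) := nontrivial_quotSMulTop_of_mem_maximalIdeal M hb1
      obtain ⟨k, hk, hkd⟩ := wb_nat (supportDim_ne_bot_of_nontrivial A (QuotSMulTop b₁ M)) h1
      rw [hd, hk] at h2
      have h2' : d + 1 ≤ k + 1 := by exact_mod_cast h2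
      rw [hk]
      congr 1; omega
    cases d with
    | zero =>
      rw [List.length_eq_zero_iff] at ha hb
      subst ha; subst hb
      apply IsRegular.of_isWeaklyRegular_of_mem_maximalIdeal _ hbm
      rw [isWeaklyRegular_singleton_iff]
      by_contra hnr
      have hmem : b₁ ∈ ⋃ p ∈ associatedPrimes A M, (p : Set A) := by
        rw [biUnion_associatedPrimes_eq_compl_regular]; exact hnr
      simp only [Set.mem_iUnion] at hmem
      obtain ⟨p, hp, hbp⟩ := hmem
      have hpr : p.IsPrime := hp.isPrime
      have hps : (⟨p, hpr⟩ : PrimeSpectrum A) ∈ Module.support A (QuotSMulTop b₁ M) := by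
        rw [support_quotSMulTop]
        refine ⟨?_, by simpa using hbp⟩
        rw [mem_support_iff_of_finite]
        rw [← Submodule.annihilator_top]
        exact hp.annihilator_le
      have hsup := support_of_supportDim_eq_zero (N := QuotSMulTop b₁ M) (R := A) (by simpa using hdb)
      rw [hsup, PrimeSpectrum.mem_zeroLocus] at hps
      have hap : a₁ ∈ p := hps (ham a₁ (by simp))
      have : a₁ ∈ ⋃ p ∈ associatedPrimes A M, (p : Set A) := by
        simp only [Set.mem_iUnion]
        exact ⟨p, hp, hap⟩
      rw [biUnion_associatedPrimes_eq_compl_regular] at this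
      exact this hr1
    | succ d =>
      have hpos : (0 : WithBot ℕ∞) < ((d + 1 : ℕ) : WithBot ℕ∞) := by exact_mod_cast Nat.succ_pos d
      obtain ⟨y, hy, hya, hyb⟩ := exists_param (QuotSMulTop a₁ M) (QuotSMulTop b₁ M)
        (by rw [hda]; exact hpos) (by rw [hdb]; exact hpos)
      rw [hda] at hya
      rw [hdb] at hyb
      replace hya := cancel_one hya
      replace hyb := cancel_one hyb
      obtain ⟨c, hcl, hcm, hcd⟩ := exists_sop d _ hya
      obtain ⟨c', hcl', hcm', hcd'⟩ := exists_sop d _ hyb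
      have s1 : IsRegular (QuotSMulTop a₁ M) (y :: c) := by
        refine ih _ hda a ha hr2 (y :: c) (by simp [hcl]) ?_ ?_
        · exact List.forall_mem_cons.mpr ⟨hy, hcm⟩
        · rw [dim_quot_cons]; exact hcd
      have s2 : IsRegular M (y :: a₁ :: c) :=
        IsLocalRing.isRegular_of_perm ((isRegular_cons_iff M _ _).mpr ⟨hr1, s1⟩) (List.Perm.swap _ _ _)
      obtain ⟨hyr, s3⟩ := (isRegular_cons_iff M _ _).mp s2
      have hdy : supportDim A (QuotSMulTop y M) = (d + 1 : ℕ) := by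
        apply cancel_one
        rw [← hd]
        exact supportDim_quotSMulTop_succ_eq_supportDim hyr hy
      have hyb' : supportDim A (QuotSMulTop b₁ (QuotSMulTop y M)) = d := by
        rw [dim_comm]; exact hyb
      obtain ⟨e, hel, hem, hed⟩ := exists_sop d _ hyb'
      have s4 : IsRegular (QuotSMulTop y M) (b₁ :: e) := by
        refine ih _ hdy (a₁ :: c) (by simp [hcl]) s3 (b₁ :: e) (by simp [hel]) ?_ ?_
        · exact List.forall_mem_cons.mpr ⟨hb1, hem⟩
        · rw [dim_quot_cons]; exact hed
      have s5 : IsRegular M (b₁ :: y :: e) :=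
        IsLocalRing.isRegular_of_perm ((isRegular_cons_iff M _ _).mpr ⟨hyr, s4⟩) (List.Perm.swap _ _ _)
      obtain ⟨hbr, s6⟩ := (isRegular_cons_iff M _ _).mp s5
      exact (isRegular_cons_iff M _ _).mpr
        ⟨hbr, ih _ hdb (y :: e) (by simp [hel]) s6 b hb hbm' hbd'⟩

end loc
end CasasAux

namespace CasasAux

open RingTheory.Sequence IsLocalRing Module

lemma supp_quot {A : Type} [CommRing A] (I : Ideal A) :
    Module.support A (A ⧸ (I • ⊤ : Submodule A A)) = PrimeSpectrum.zeroLocus (I : Set A) := by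
  rw [Module.support_quotient]
  have : Module.support A A = Set.univ := by
    rw [Module.support_eq_zeroLocus, Module.annihilator_eq_bot.mpr inferInstance]
    simp
  rw [this, Set.univ_inter]

lemma dim_le_zero {A : Type} [CommRing A] [IsLocalRing A] {I : Ideal A}
    (h : maximalIdeal A ≤ I.radical) :
    supportDim A (A ⧸ (I • ⊤ : Submodule A A)) ≤ 0 := by
  unfold supportDim
  rw [supp_quot]
  have key : ∀ p : PrimeSpectrum A, p ∈ PrimeSpectrum.zeroLocus (I : Set A) →
      p.asIdeal = maximalIdeal A := by
    intro p hp
    rw [PrimeSpectrum.mem_zeroLocus] at hp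
    have h1 : I.radical ≤ p.asIdeal := p.2.radical_le_iff.mpr hp
    exact le_antisymm (le_maximalIdeal p.2.ne_top) (h.trans h1)
  have : Subsingleton (PrimeSpectrum.zeroLocus (I : Set A)) :=
    ⟨fun p q => Subtype.ext (PrimeSpectrum.ext ((key _ p.2).trans (key _ q.2).symm))⟩
  exact Order.krullDim_nonpos_of_subsingleton

section poly
variable {K : Type} [Field K] {m : ℕ}

lemma mem_idealOfVars (f : MvPolynomial (Fin m) K) :
    f ∈ idealOfVars (Fin m) K ↔ MvPolynomial.constantCoeff f = 0 := by
  have := mem_pow_idealOfVars_iff' (σ := Fin m) (R := K) 1 f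
  rw [pow_one] at this
  rw [this]
  simp only [Nat.lt_one_iff, Finsupp.degree_eq_zero_iff, forall_eq]
  rfl

instance idealOfVars_prime : (idealOfVars (Fin m) K).IsPrime := by
  have : idealOfVars (Fin m) K = RingHom.ker (MvPolynomial.constantCoeff (R := K) (σ := Fin m)) := by
    ext f
    rw [mem_idealOfVars, RingHom.mem_ker]
  rw [this]
  exact RingHom.ker_isPrime _

lemma ofFn_take_set {R : Type*} (F : Fin m → R) (i : ℕ) :
    {r | r ∈ (List.ofFn F).take i} = F '' {j | (j : ℕ) < i} := by
  ext r
  simp only [Set.mem_ofPred_eq, Set.mem_image, List.mem_take_iff_getElem]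
  constructor
  · rintro ⟨j, hj, rfl⟩
    simp only [List.length_ofFn, lt_min_iff] at hj
    exact ⟨⟨j, hj.2⟩, hj.1, by simp⟩
  · rintro ⟨j, hj, rfl⟩
    exact ⟨j, by simp; exact hj, by simp⟩

lemma X_weakly : IsWeaklyRegular (MvPolynomial (Fin m) K)
    (List.ofFn (fun i => (MvPolynomial.X i : MvPolynomial (Fin m) K))) := by
  rw [isWeaklyRegular_iff]
  intro i hi
  rw [isSMulRegular_quotient_iff_mem_of_smul_mem]
  intro f hf
  rw [smul_eq_mul, Ideal.mul_top, Ideal.ofList, ofFn_take_set, mem_ideal_span_X_image] at hf ⊢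
  intro d hd
  have hi' : i < m := by simpa using hi
  obtain ⟨j, hj, hj2⟩ := hf (d + Finsupp.single ⟨i, hi'⟩ 1) (by
    rw [smul_eq_mul, List.getElem_ofFn, mul_comm, MvPolynomial.mem_support_iff, MvPolynomial.coeff_mul_X]
    exact MvPolynomial.mem_support_iff.mp hd)
  refine ⟨j, hj, ?_⟩
  have hne : (⟨i, hi'⟩ : Fin m) ≠ j := by
    rintro rfl
    exact lt_irrefl i hj
  rwa [Finsupp.add_apply, Finsupp.single_eq_of_ne' hne, add_zero] at hj2

variable (K m) in
/-- The local ring at the origin. -/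
abbrev Loc : Type := Localization.AtPrime (idealOfVars (Fin m) K)

lemma X_regular : IsRegular (Loc K m) ((List.ofFn (fun i => (MvPolynomial.X i :
    MvPolynomial (Fin m) K))).map (algebraMap _ (Loc K m))) := by
  refine IsWeaklyRegular.isRegular_of_isLocalization_of_mem (Loc K m) (idealOfVars (Fin m) K) X_weakly ?_
  intro r hr
  rw [List.mem_ofFn] at hr
  obtain ⟨i, rfl⟩ := hr
  exact Ideal.subset_span ⟨i, rfl⟩

instance : IsNoetherianRing (Loc K m) :=
  IsLocalization.isNoetherianRing (idealOfVars (Fin m) K).primeCompl _ inferInstance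

lemma ofFn_set {R : Type*} (F : Fin m → R) : {r | r ∈ List.ofFn F} = Set.range F := by
  ext r; simp [List.mem_ofFn]

lemma max_eq : maximalIdeal (Loc K m) = (idealOfVars (Fin m) K).map (algebraMap _ (Loc K m)) :=
  (Localization.AtPrime.map_eq_maximalIdeal).symm

lemma loc_dim_le (F : Fin m → MvPolynomial (Fin m) K)
    (h : idealOfVars (Fin m) K ≤ (Ideal.span (Set.range F)).radical) :
    supportDim (Loc K m) (Loc K m ⧸ Ideal.ofList ((List.ofFn F).map (algebraMap _ (Loc K m))) •
      (⊤ : Submodule (Loc K m) (Loc K m))) ≤ 0 := by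
  apply dim_le_zero
  rw [max_eq, ← Ideal.map_ofList, Ideal.ofList, ofFn_set]
  exact (Ideal.map_mono h).trans (Ideal.map_radical_le _)

lemma loc_dim : supportDim (Loc K m) (Loc K m) = m := by
  have h := supportDim_add_length_eq_supportDim_of_isRegular _ (X_regular (K := K) (m := m))
  have h2 := loc_dim_le (fun i => (MvPolynomial.X i : MvPolynomial (Fin m) K)) Ideal.le_radical
  have hne : supportDim (Loc K m) (Loc K m ⧸ Ideal.ofList ((List.ofFn (fun i => (MvPolynomial.X i :
    MvPolynomial (Fin m) K))).map (algebraMap _ (Loc K m))) •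
      (⊤ : Submodule (Loc K m) (Loc K m))) ≠ ⊥ := by
    intro hb
    rw [hb, WithBot.bot_add] at h
    rw [Eq.comm, supportDim_eq_bot_iff_subsingleton] at h
    exact not_subsingleton _ h
  obtain ⟨k, hk, hk0⟩ := wb_nat hne (n := 0) (by simpa using h2)
  obtain rfl : k = 0 := by omega
  rw [hk] at h
  rw [← h]
  simp

lemma span_homog (F : Fin m → MvPolynomial (Fin m) K) (e : Fin m → ℕ)
    (hF : ∀ i, (F i).IsHomogeneous (e i)) (s : Set (Fin m)) :
    letI := MvPolynomial.gradedAlgebra (σ := Fin m) (R := K)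
    (Ideal.span (F '' s)).IsHomogeneous (homogeneousSubmodule (Fin m) K) := by
  letI := MvPolynomial.gradedAlgebra (σ := Fin m) (R := K)
  apply Ideal.homogeneous_span
  rintro _ ⟨i, -, rfl⟩
  exact ⟨e i, hF i⟩

lemma descend (F : Fin m → MvPolynomial (Fin m) K) (e : Fin m → ℕ)
    (hF : ∀ i, (F i).IsHomogeneous (e i)) (s : Set (Fin m)) (f : MvPolynomial (Fin m) K)
    (hf : algebraMap _ (Loc K m) f ∈ (Ideal.span (F '' s)).map (algebraMap _ (Loc K m))) :
    f ∈ Ideal.span (F '' s) := by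
  rw [IsLocalization.algebraMap_mem_map_algebraMap_iff (idealOfVars (Fin m) K).primeCompl] at hf
  obtain ⟨u, hu, huf⟩ := hf
  have hc : MvPolynomial.constantCoeff u ≠ 0 := fun h => hu ((mem_idealOfVars u).mpr h)
  set I := Ideal.span (F '' s) with hI
  let t := 1 - MvPolynomial.C (MvPolynomial.constantCoeff u)⁻¹ * u
  have ht : t ∈ idealOfVars (Fin m) K := by
    rw [mem_idealOfVars]
    simp [t, hc]
  have h1 : f - t * f ∈ I := by
    have : f - t * f = MvPolynomial.C (MvPolynomial.constantCoeff u)⁻¹ * (u * f) := by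
      simp only [t]; ring
    rw [this]
    exact I.mul_mem_left _ huf
  have h2 : ∀ N : ℕ, f - t ^ N * f ∈ I := by
    intro N
    induction N with
    | zero => simp
    | succ N ih =>
      have : f - t ^ (N + 1) * f = (f - t ^ N * f) + t ^ N * (f - t * f) := by ring
      rw [this]
      exact I.add_mem ih (I.mul_mem_left _ h1)
  rw [mem_iff_homogeneousComponent_mem (span_homog F e hF s)]
  intro k
  have h3 := homogeneousComponent_mem_of_mem (span_homog F e hF s) (h2 (k + 1)) k
  rw [map_sub] at h3
  have h4 : homogeneousComponent k (t ^ (k + 1) * f) = 0 := by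
    apply homogeneousComponent_eq_zero'
    intro d hd
    have := (mem_pow_idealOfVars_iff (k + 1) (t ^ (k + 1) * f)).mp
      (Ideal.mul_mem_right _ _ (Ideal.pow_mem_pow ht _)) d hd
    omega
  rwa [h4, sub_zero] at h3

lemma homog_mem (f : MvPolynomial (Fin m) K) (e : ℕ) (he : 0 < e) (hf : f.IsHomogeneous e) :
    f ∈ idealOfVars (Fin m) K := by
  rw [mem_idealOfVars]
  by_contra h
  have := hf (d := 0) h
  simp at this
  omega

lemma regular_of_zero [IsAlgClosed K] (F : Fin m → MvPolynomial (Fin m) K) (e : Fin m → ℕ)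
    (he : ∀ i, 0 < e i) (hF : ∀ i, (F i).IsHomogeneous (e i))
    (h0 : ∀ a : Fin m → K, (∀ i, MvPolynomial.aeval a (F i) = 0) → a = 0) :
    IsRegular (MvPolynomial (Fin m) K) (List.ofFn F) := by
  have hrad : idealOfVars (Fin m) K ≤ (Ideal.span (Set.range F)).radical := by
    rw [← vanishingIdeal_zeroLocus_eq_radical (K := K)]
    intro f hf a ha
    have : a = 0 := by
      apply h0
      intro i
      exact ha _ (Ideal.subset_span ⟨i, rfl⟩)
    subst this
    rw [mem_idealOfVars] at hf
    simpa using hf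
  have hmem : ∀ i, F i ∈ idealOfVars (Fin m) K := fun i => homog_mem _ _ (he i) (hF i)
  have hreg : IsRegular (Loc K m) ((List.ofFn F).map (algebraMap _ (Loc K m))) := by
    refine sop_regular m (Loc K m) loc_dim _ (by simp) X_regular _ (by simp) ?_ (loc_dim_le F hrad)
    intro x hx
    simp only [List.mem_map, List.mem_ofFn] at hx
    obtain ⟨_, ⟨i, rfl⟩, rfl⟩ := hx
    rw [max_eq]
    exact Ideal.mem_map_of_mem _ (hmem i)
  refine ⟨?_, ?_⟩
  · rw [isWeaklyRegular_iff]
    intro i hi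
    have hi' : i < m := by simpa using hi
    rw [isSMulRegular_quotient_iff_mem_of_smul_mem]
    intro f hf
    have hw := (isWeaklyRegular_iff _ _).mp hreg.1 i (by simpa using hi)
    rw [isSMulRegular_quotient_iff_mem_of_smul_mem] at hw
    have hw := hw (algebraMap _ _ f)
    rw [smul_eq_mul, Ideal.mul_top, ← List.map_take, ← Ideal.map_ofList, Ideal.ofList, ofFn_take_set] at hw
    rw [smul_eq_mul, Ideal.mul_top, Ideal.ofList, ofFn_take_set] at hf ⊢
    apply descend F e hF
    apply hw
    rw [List.getElem_map, smul_eq_mul, ← map_mul]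
    exact Ideal.mem_map_of_mem _ hf
  · intro h
    rw [smul_eq_mul, Ideal.mul_top, Ideal.ofList, ofFn_set] at h
    have h1 : Ideal.span (Set.range F) ≤ idealOfVars (Fin m) K := by
      rw [Ideal.span_le]
      rintro _ ⟨i, rfl⟩
      exact hmem i
    rw [← h, top_le_iff] at h1
    exact idealOfVars_prime.ne_top h1

lemma zero_of_regular (F : Fin m → MvPolynomial (Fin m) K) (e : Fin m → ℕ)
    (he : ∀ i, 0 < e i) (hF : ∀ i, (F i).IsHomogeneous (e i))
    (hreg : IsRegular (MvPolynomial (Fin m) K) (List.ofFn F))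
    (a : Fin m → K) (ha : ∀ i, MvPolynomial.aeval a (F i) = 0) : a = 0 := by
  have hmem : ∀ i, F i ∈ idealOfVars (Fin m) K := fun i => homog_mem _ _ (he i) (hF i)
  have hl : IsRegular (Loc K m) ((List.ofFn F).map (algebraMap _ (Loc K m))) := by
    refine IsWeaklyRegular.isRegular_of_isLocalization_of_mem (Loc K m) (idealOfVars (Fin m) K) hreg.1 ?_
    intro r hr
    rw [List.mem_ofFn] at hr
    obtain ⟨i, rfl⟩ := hr
    exact hmem i
  have hd := supportDim_add_length_eq_supportDim_of_isRegular _ hl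
  rw [loc_dim] at hd
  simp only [List.length_map, List.length_ofFn] at hd
  have hd0 : supportDim (Loc K m) (Loc K m ⧸ Ideal.ofList ((List.ofFn F).map (algebraMap _ (Loc K m))) •
      (⊤ : Submodule (Loc K m) (Loc K m))) = 0 := by
    generalize supportDim (Loc K m) (Loc K m ⧸ Ideal.ofList ((List.ofFn F).map (algebraMap _ (Loc K m))) •
      (⊤ : Submodule (Loc K m) (Loc K m))) = x at hd
    cases x with
    | bot => simp at hd
    | coe x =>
      have hd' : x + (m : ℕ∞) = (m : ℕ∞) := by exact_mod_cast hd
      cases x with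
      | top => simp at hd'
      | coe x =>
        have : x + m = m := by exact_mod_cast hd'
        obtain rfl : x = 0 := by omega
        rfl
  have hs := support_of_supportDim_eq_zero _ _ hd0
  rw [supp_quot] at hs
  let φ : MvPolynomial (Fin m) K →ₐ[K] K[X] :=
    MvPolynomial.aeval (fun i => Polynomial.C (a i) * Polynomial.X)
  let P : Ideal (MvPolynomial (Fin m) K) := RingHom.ker φ
  have hP : P.IsPrime := RingHom.ker_isPrime _
  have hFP : ∀ i, F i ∈ P := by
    intro i
    rw [RingHom.mem_ker]
    have : φ (F i) = Polynomial.C (MvPolynomial.aeval a (F i)) * Polynomial.X ^ (e i) := by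
      simp only [φ, MvPolynomial.aeval_def, MvPolynomial.eval₂_eq]
      rw [map_sum, Finset.sum_mul]
      refine Finset.sum_congr rfl fun d hd => ?_
      have hdeg : d.degree = e i := by
        rw [Finsupp.degree_eq_weight_one]
        exact hF i (MvPolynomial.mem_support_iff.mp hd)
      simp only [mul_pow, Finset.prod_mul_distrib, Finset.prod_pow_eq_pow_sum, map_mul, map_prod, map_pow]
      rw [← mul_assoc]
      congr 1
      rw [← hdeg]
      rfl
    rw [this, ha, map_zero, zero_mul]
  have hPm : P ≤ idealOfVars (Fin m) K := by
    intro f hf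
    rw [RingHom.mem_ker] at hf
    rw [mem_idealOfVars]
    have : Polynomial.constantCoeff (φ f) = MvPolynomial.constantCoeff f := by
      have h : (Polynomial.constantCoeff (R := K)).comp φ.toRingHom = MvPolynomial.constantCoeff := by
        apply MvPolynomial.ringHom_ext
        · intro c
          simp [φ]
        · intro i
          simp [φ]
      exact RingHom.congr_fun h f
    rw [← this, hf, map_zero]
  have hdis : Disjoint ((idealOfVars (Fin m) K).primeCompl : Set (MvPolynomial (Fin m) K)) P := by
    rw [Set.disjoint_left]
    intro x hx hxP
    exact hx (hPm hxP)
  have hQ := IsLocalization.isPrime_of_isPrime_disjoint (idealOfVars (Fin m) K).primeCompl (Loc K m) P hP hdis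
  have hin : (⟨_, hQ⟩ : PrimeSpectrum (Loc K m)) ∈ PrimeSpectrum.zeroLocus
      ((Ideal.ofList ((List.ofFn F).map (algebraMap _ (Loc K m))) : Ideal (Loc K m)) : Set (Loc K m)) := by
    rw [PrimeSpectrum.mem_zeroLocus, ← Ideal.map_ofList, Ideal.ofList, ofFn_set]
    apply Ideal.map_mono
    rw [Ideal.span_le]
    rintro _ ⟨i, rfl⟩
    exact hFP i
  rw [hs, PrimeSpectrum.mem_zeroLocus] at hin
  have hin : maximalIdeal (Loc K m) ≤ P.map (algebraMap _ (Loc K m)) := hin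
  funext i
  have h1 : algebraMap _ (Loc K m) (MvPolynomial.X i : MvPolynomial (Fin m) K) ∈ P.map (algebraMap _ (Loc K m)) := by
    apply hin
    rw [max_eq]
    exact Ideal.mem_map_of_mem _ (Ideal.subset_span ⟨i, rfl⟩)
  have h2 : (MvPolynomial.X i : MvPolynomial (Fin m) K) ∈ P := by
    rw [← IsLocalization.under_map_of_isPrime_disjoint (idealOfVars (Fin m) K).primeCompl (Loc K m) hP hdis]
    exact h1
  rw [RingHom.mem_ker] at h2
  simpa [φ] using h2

end poly

lemma G_homog {K : Type} [Field K] {m : ℕ} (T : Fin m → Fin (m + 1)) (i : Fin m) :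
    (G K (m + 1) T i : MvPolynomial (Fin m) K).IsHomogeneous ((i : ℕ) + 1) := by
  have hes : (MvPolynomial.esymm (Fin m) K ((i : ℕ) + 1)).IsHomogeneous ((i : ℕ) + 1) := by
    unfold MvPolynomial.esymm
    apply MvPolynomial.IsHomogeneous.sum
    intro t ht
    have := MvPolynomial.IsHomogeneous.prod t (fun i => (MvPolynomial.X i : MvPolynomial (Fin m) K))
      (fun _ => 1) (fun i _ => MvPolynomial.isHomogeneous_X _ _)
    simpa [(Finset.mem_powersetCard.mp ht).2] using this
  change MvPolynomial.IsHomogeneous ((if h : (T i : ℕ) < m then Phi K ⟨T i, h⟩ else AlgHom.id K _ :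
    MvPolynomial (Fin m) K →ₐ[K] MvPolynomial (Fin m) K) (MvPolynomial.esymm (Fin m) K ((i : ℕ) + 1))) _
  split_ifs with h
  · unfold Phi
    have := hes.aeval (fun k => if k = (⟨T i, h⟩ : Fin m) then -MvPolynomial.X (⟨T i, h⟩ : Fin m) else
      MvPolynomial.X k - (MvPolynomial.X (⟨T i, h⟩ : Fin m) : MvPolynomial (Fin m) K)) (n := 1) (by
        intro k
        split_ifs
        · exact (MvPolynomial.isHomogeneous_X _ _).neg
        · exact (MvPolynomial.isHomogeneous_X _ _).sub (MvPolynomial.isHomogeneous_X _ _))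
    rwa [one_mul] at this
  · exact hes

end CasasAux

namespace CasasAux

/-- The evaluation point belonging to `Φ_j`. -/
noncomputable def pt {K : Type} [Field K] {m : ℕ} (a : Fin m → K) (j : Fin (m + 1)) : Fin m → K :=
  if h : (j : ℕ) < m then fun i => if i = ⟨j, h⟩ then - a ⟨j, h⟩ else a i - a ⟨j, h⟩ else a

lemma eval_PhiFull {K : Type} [Field K] {m : ℕ} (a : Fin m → K) (j : Fin (m + 1))
    (q : MvPolynomial (Fin m) K) :
    MvPolynomial.aeval a (PhiFull K (m + 1) j q) = MvPolynomial.aeval (pt a j) q := by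
  unfold PhiFull pt
  change MvPolynomial.aeval a ((if h : (j : ℕ) < m then Phi K ⟨j, h⟩ else AlgHom.id K _ : MvPolynomial (Fin m) K →ₐ[K] MvPolynomial (Fin m) K) q) = _
  split_ifs with h
  · unfold Phi
    rw [← AlgHom.comp_apply, MvPolynomial.comp_aeval]
    congr 2
    funext i
    split_ifs <;> simp
  · rfl

/-- The polynomial with roots `r`. -/
noncomputable def rootPoly {K : Type} [Field K] {m : ℕ} (r : Fin (m + 1) → K) : K[X] :=
  ∏ k, (Polynomial.X - Polynomial.C (r k))

lemma taylor_rootPoly {K : Type} [Field K] {m : ℕ} (r : Fin (m + 1) → K) (j : Fin (m + 1)) :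
    Polynomial.taylor (r j) (rootPoly r) = Polynomial.X * ∏ i : Fin m, (Polynomial.X -
      Polynomial.C (pt (fun i => r i.castSucc - r (Fin.last m)) j i)) := by
  have h1 : Polynomial.taylor (r j) (rootPoly r) = ∏ k, (Polynomial.X - Polynomial.C (r k - r j)) := by
    unfold rootPoly
    rw [← Polynomial.taylorAlgHom_apply, map_prod]
    refine Finset.prod_congr rfl fun k _ => ?_
    simp [Polynomial.taylorAlgHom_apply]
    ring
  rw [h1, Fin.prod_univ_castSucc]
  refine Fin.lastCases ?_ (fun j => ?_) j
  · simp [pt, mul_comm]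
  · have hj : ((j.castSucc : Fin (m + 1)) : ℕ) < m := by simp
    simp only [pt, hj, dif_pos]
    rw [← Finset.mul_prod_erase Finset.univ _ (Finset.mem_univ j),
      ← Finset.mul_prod_erase Finset.univ (fun i => Polynomial.X - Polynomial.C (ite _ _ _)) (Finset.mem_univ j)]
    have : ∏ x ∈ Finset.univ.erase j, (Polynomial.X - Polynomial.C (r x.castSucc - r j.castSucc))
      = ∏ x ∈ Finset.univ.erase j, (Polynomial.X - Polynomial.C (if x = ⟨(j.castSucc : Fin (m + 1)), hj⟩ then
          -(r (Fin.castSucc ⟨(j.castSucc : Fin (m + 1)), hj⟩) - r (Fin.last m)) else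
          r x.castSucc - r (Fin.last m) - (r (Fin.castSucc ⟨(j.castSucc : Fin (m + 1)), hj⟩) - r (Fin.last m)))) := by
      refine Finset.prod_congr rfl fun x hx => ?_
      have hx' : x ≠ ⟨(j.castSucc : Fin (m + 1)), hj⟩ := Finset.ne_of_mem_erase hx
      rw [if_neg hx']
      congr 2
      change _ = r x.castSucc - r (Fin.last m) - (r j.castSucc - r (Fin.last m))
      ring
    rw [this]
    have e : (⟨(j.castSucc : Fin (m + 1)), hj⟩ : Fin m) = j := rfl
    simp only [e, if_true]
    simp
    ring

lemma eval_G {K : Type} [Field K] {m : ℕ} (a : Fin m → K) (T : Fin m → Fin (m + 1)) (i : Fin m) :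
    MvPolynomial.aeval a (G K (m + 1) T i) =
      MvPolynomial.aeval (pt a (T i)) (MvPolynomial.esymm (Fin m) K ((i : ℕ) + 1)) :=
  eval_PhiFull a (T i) _

/-- Evaluation of the Hasse derivatives at a root. -/
lemma hasse_eval {K : Type} [Field K] {m : ℕ} (r : Fin (m + 1) → K) (j : Fin (m + 1)) (i : Fin m) :
    (Polynomial.hasseDeriv (m - i) (rootPoly r)).eval (r j) = (-1) ^ ((i : ℕ) + 1) *
      MvPolynomial.aeval (pt (fun i => r i.castSucc - r (Fin.last m)) j)
        (MvPolynomial.esymm (Fin m) K ((i : ℕ) + 1)) := by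
  have hi := i.2
  rw [← Polynomial.taylor_coeff, taylor_rootPoly, MvPolynomial.aeval_esymm_eq_multiset_esymm]
  generalize pt (fun i => r i.castSucc - r (Fin.last m)) j = y
  obtain ⟨k, hk⟩ : ∃ k, m - i = k + 1 := ⟨m - i - 1, by omega⟩
  rw [hk, Polynomial.coeff_X_mul]
  have := Multiset.prod_X_sub_C_coeff (Finset.univ.val.map y) (k := k) (by simp; omega)
  rw [Multiset.map_map] at this
  simp only [Multiset.card_map, Finset.card_val, Finset.card_univ, Fintype.card_fin] at this
  have e : m - k = i + 1 := by omega
  rw [e] at this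
  exact this

lemma rootPoly_natDegree {K : Type} [Field K] {m : ℕ} (r : Fin (m + 1) → K) :
    (rootPoly r).Monic ∧ (rootPoly r).natDegree = m + 1 := by
  constructor
  · exact Polynomial.monic_prod_of_monic _ _ fun i _ => Polynomial.monic_X_sub_C _
  · unfold rootPoly
    rw [Polynomial.natDegree_prod_of_monic _ _ fun i _ => Polynomial.monic_X_sub_C _]
    simp

lemma exists_rootPoly {K : Type} [Field K] [IsAlgClosed K] {m : ℕ} (f : K[X]) (hf : f.Monic)
    (hd : f.natDegree = m + 1) : ∃ r : Fin (m + 1) → K, f = rootPoly r := by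
  have hs := IsAlgClosed.splits f
  have h := hs.eq_prod_roots_of_monic hf
  have hc : Multiset.card f.roots = m + 1 := by rw [← hd]; exact hs.natDegree_eq_card_roots.symm
  have hl : f.roots.toList.length = m + 1 := by simpa using hc
  refine ⟨fun k => f.roots.toList.get (k.cast hl.symm), ?_⟩
  conv_lhs => rw [h, ← Multiset.coe_toList f.roots]
  rw [Multiset.map_coe, Multiset.prod_coe]
  unfold rootPoly
  rw [← List.prod_ofFn]
  congr 1
  apply List.ext_getElem
  · simp [hc]
  · intro n h1 h2
    rw [List.getElem_map, List.getElem_ofFn]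
    rfl

lemma ca_iff {K : Type} [Field K] [IsAlgClosed K] (m : ℕ) :
    (∀ f : K[X], IsCasasAlvero (m + 1) f → ∃ b : K, f = (Polynomial.X - Polynomial.C b) ^ (m + 1)) ↔
    ∀ T : Fin m → Fin (m + 1), ∀ a : Fin m → K,
      (∀ i, MvPolynomial.aeval a (G K (m + 1) T i) = 0) → a = 0 := by
  constructor
  · intro H T a ha
    let r : Fin (m + 1) → K := Fin.snoc a 0
    have hra : (fun i : Fin m => r i.castSucc - r (Fin.last m)) = a := by
      funext i; simp [r]
    have hroot : ∀ j, (rootPoly r).IsRoot (r j) := by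
      intro j
      simp [rootPoly, Polynomial.eval_prod, Finset.prod_eq_zero_iff, sub_eq_zero]
    obtain ⟨b, hb⟩ := H (rootPoly r) ⟨(rootPoly_natDegree r).1, (rootPoly_natDegree r).2, by
      intro i hi
      rw [Finset.mem_Ioo] at hi
      let k : Fin m := ⟨m - i, by omega⟩
      refine ⟨Polynomial.X - Polynomial.C (r (T k)), by simp, ?_, ?_⟩
      · rw [Polynomial.dvd_iff_isRoot]; exact hroot _
      · rw [Polynomial.dvd_iff_isRoot]
        have := hasse_eval r (T k) k
        have e : m - (k : ℕ) = i := by simp [k]; omega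
        have e2 := (eval_G a T k).symm.trans (ha k)
        rw [e, hra, e2] at this
        rw [Polynomial.IsRoot, this]
        simp⟩
    have hall : ∀ j, r j = b := by
      intro j
      have := hroot j
      rw [hb] at this
      simpa [sub_eq_zero] using this
    funext i
    have h1 := congrFun hra i
    rw [← h1]
    simp [hall]
  · intro H f ⟨hm, hd, hf⟩
    obtain ⟨r, rfl⟩ := exists_rootPoly f hm hd
    have : ∀ i : Fin m, ∃ j : Fin (m + 1), (Polynomial.hasseDeriv (m - i) (rootPoly r)).eval (r j) = 0 := by
      intro i
      have hi := i.2
      obtain ⟨g, hg0, hg1, hg2⟩ := hf (m - i) (by rw [Finset.mem_Ioo]; omega)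
      obtain ⟨ρ, hρ⟩ := IsAlgClosed.exists_root g hg0.ne'
      have h1 : (rootPoly r).eval ρ = 0 := Polynomial.eval_eq_zero_of_dvd_of_eval_eq_zero hg1 hρ
      simp only [rootPoly, Polynomial.eval_prod, Finset.prod_eq_zero_iff, Polynomial.eval_sub, Polynomial.eval_X,
        Polynomial.eval_C, sub_eq_zero] at h1
      obtain ⟨j, -, rfl⟩ := h1
      exact ⟨j, Polynomial.eval_eq_zero_of_dvd_of_eval_eq_zero hg2 hρ⟩
    choose T hT using this
    have h0 := H T (fun i => r i.castSucc - r (Fin.last m)) (by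
      intro i
      have := hT i
      rw [hasse_eval] at this
      rcases mul_eq_zero.mp this with h | h
      · exact absurd h (by simp)
      · exact (eval_G _ T i).trans h)
    refine ⟨r (Fin.last m), ?_⟩
    have hall : ∀ k, r k = r (Fin.last m) := by
      intro k
      refine Fin.lastCases rfl (fun i => ?_) k
      exact sub_eq_zero.mp (congrFun h0 i)
    unfold rootPoly
    rw [Finset.prod_congr rfl (fun k _ => by rw [hall k])]
    simp

end CasasAux

/-- **(Ghosh).** Over an algebraically closed field `K` of characteristic `p` (`p` prime or `0`),
the Casas–Alvero conjecture holds in degree `n` iff for every `T ∈ {1,…,n}^{n-1}` the sequence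
`(G_{T,1},…,G_{T,n-1})` is a regular sequence in `K[x_1,…,x_{n-1}]`. -/
theorem casasAlvero_iff_regular_sequences (n : ℕ) (hn : 2 ≤ n) (p : ℕ)
    (hp : p = 0 ∨ p.Prime) (K : Type) [Field K] [IsAlgClosed K] [CharP K p] :
    (∀ f : Polynomial K, IsCasasAlvero n f →
        ∃ b : K, f = (Polynomial.X - Polynomial.C b) ^ n) ↔
      ∀ T : Fin (n - 1) → Fin n,
        RingTheory.Sequence.IsRegular (MvPolynomial (Fin (n - 1)) K)
          (List.ofFn fun i => G K n T i) := by
  obtain ⟨m, rfl⟩ : ∃ m, n = m + 1 := ⟨n - 1, by omega⟩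
  refine (CasasAux.ca_iff m).trans (forall_congr' fun T => ?_)
  constructor
  · intro h
    exact CasasAux.regular_of_zero (m := m) (G K (m + 1) T) (fun i => (i : ℕ) + 1)
      (fun i => Nat.succ_pos _) (CasasAux.G_homog T) h
  · intro h a ha
    exact CasasAux.zero_of_regular (m := m) (G K (m + 1) T) (fun i => (i : ℕ) + 1)
      (fun i => Nat.succ_pos _) (CasasAux.G_homog T) h a ha
end
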